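/- Let m ≥ 1, let f : ℂ^m → ℂ be a nonconstant entire function, let u ∈ ℂ^m be a unit vector, and let k, n be positive integers with n ≥ k + 1 such that ∂_u^k(f^n) is not identically zero. If f^n = ∂_u^k(f^n) identically on ℂ^m, then there exists c ∈ ℂ \ {0} with (c/n)^k = 1 such that f = c·∂_u f identically on ℂ^m. (Case 2 of the proof of the paper's Theorem 2.1.) -/

import Mathlib

/-- The directional derivative of `f : ℂ^m → ℂ` along the direction `u`. -/
noncomputable def dirDeriv {m : ℕ} (u : Fin m → ℂ) (f : (Fin m → ℂ) → ℂ) :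
    (Fin m → ℂ) → ℂ :=
  fun z => fderiv ℂ f z u

open Metric Filter Topology

section

variable {E : Type*} [NormedAddCommGroup E] [NormedSpace ℂ E]

lemma Differentiable.hasDerivAt_comp_line {f : E → ℂ} (hf : Differentiable ℂ f) (z u : E) (t : ℂ) :
    HasDerivAt (fun s : ℂ => f (z + s • u)) (fderiv ℂ f (z + t • u) u) t := by
  have h : HasDerivAt (fun s : ℂ => z + s • u) u t := by
    simpa using ((hasDerivAt_id t).smul_const u).const_add z
  exact (hf _).hasFDerivAt.comp_hasDerivAt t h

lemma Differentiable.comp_line {f : E → ℂ} (hf : Differentiable ℂ f) (z u : E) :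
    Differentiable ℂ fun s : ℂ => f (z + s • u) :=
  fun t => (hf.hasDerivAt_comp_line z u t).differentiableAt

/-- Cauchy's estimate for the Fréchet derivative of an entire function. -/
lemma Differentiable.norm_fderiv_le_of_forall_mem_closedBall {f : E → ℂ} (hf : Differentiable ℂ f)
    {x : E} {C : ℝ} (hC : ∀ y ∈ closedBall x 1, ‖f y‖ ≤ C) : ‖fderiv ℂ f x‖ ≤ C := by
  have hC0 : 0 ≤ C := (norm_nonneg _).trans (hC x (by simp))
  refine ContinuousLinearMap.opNorm_le_bound _ hC0 fun v => ?_
  rcases eq_or_ne v 0 with rfl | hv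
  · simp
  have hv' : 0 < ‖v‖ := norm_pos_iff.2 hv
  have h := Complex.norm_deriv_le_of_forall_mem_sphere_norm_le (c := 0) (R := ‖v‖⁻¹) (C := C)
    (inv_pos.2 hv') (hf.comp_line x v).diffContOnCl fun t ht => hC _ (by
      rw [mem_sphere_zero_iff_norm] at ht
      simp [norm_smul, ht, hv'.ne'])
  rw [(hf.hasDerivAt_comp_line x v 0).deriv] at h
  simpa using h

/-- A directional derivative of an entire function of several variables is entire. -/
lemma Differentiable.fderiv_apply_const [FiniteDimensional ℂ E] {f : E → ℂ} (hf : Differentiable ℂ f)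
    (u : E) : Differentiable ℂ fun z => fderiv ℂ f z u := by
  borelize E
  have : ProperSpace E := FiniteDimensional.proper ℂ E
  have : ProperSpace (E →L[ℂ] ℂ) := FiniteDimensional.proper ℂ _
  let K : ℝ → ℂ := fun θ => _root_.deriv (circleMap 0 1) θ * (1 / (circleMap 0 1 θ - 0) ^ 2)
  have hK : Continuous K := by
    have h0 : ∀ θ, circleMap 0 1 θ - 0 ≠ 0 := fun θ => by simp
    simp only [K, deriv_circleMap]
    refine Continuous.mul (by fun_prop) (Continuous.div (by fun_prop) (by fun_prop) ?_)
    exact fun θ => pow_ne_zero 2 (h0 θ)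
  have hrep : (fun z => fderiv ℂ f z u) = fun z =>
      (2 * Real.pi * Complex.I)⁻¹ * ∫ θ in Set.Ioc 0 (2 * Real.pi),
        K θ * f (z + circleMap 0 1 θ • u) := by
    funext z
    have h := DiffContOnCl.deriv_eq_smul_circleIntegral (c := 0) one_pos
      (hf.comp_line z u).diffContOnCl
    rw [(hf.hasDerivAt_comp_line z u 0).deriv, circleIntegral,
      intervalIntegral.integral_of_le Real.two_pi_pos.le] at h
    simp only [smul_eq_mul, ← mul_assoc, zero_smul, add_zero] at h
    simp only [K]
    rw [h, inv_mul_cancel_left₀ Complex.two_pi_I_ne_zero]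
  rw [hrep]
  refine Differentiable.const_mul (fun x₀ => ?_) _
  obtain ⟨C, hC⟩ := (isCompact_closedBall x₀ (‖u‖ + 2)).exists_bound_of_continuousOn
    hf.continuous.continuousOn
  have hline : Continuous fun θ : ℝ => x₀ + circleMap 0 1 θ • u := by fun_prop
  refine (hasFDerivAt_integral_of_dominated_of_fderiv_le (𝕜 := ℂ)
    (F' := fun x θ => K θ • fderiv ℂ f (x + circleMap 0 1 θ • u))
    (bound := fun θ => ‖K θ‖ * C) (ball_mem_nhds x₀ one_pos) ?_ ?_ ?_ ?_ ?_ ?_).differentiableAt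
  · refine Eventually.of_forall fun x => Continuous.aestronglyMeasurable ?_
    have := hf.continuous
    fun_prop
  · refine (Continuous.integrableOn_Icc ?_).mono_set Set.Ioc_subset_Icc_self
    have := hf.continuous
    fun_prop
  · refine hK.aestronglyMeasurable.smul (Measurable.aestronglyMeasurable ?_)
    exact (measurable_fderiv ℂ f).comp hline.measurable
  · refine Eventually.of_forall fun θ x hx => ?_
    rw [norm_smul]
    refine mul_le_mul_of_nonneg_left ?_ (norm_nonneg _)
    refine hf.norm_fderiv_le_of_forall_mem_closedBall fun y hy => hC y ?_
    have h1 : Dist.dist (x + circleMap 0 1 θ • u) x = ‖u‖ := by simp [dist_eq_norm, norm_smul]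
    have h2 := dist_triangle4 y (x + circleMap 0 1 θ • u) x x₀
    rw [mem_ball] at hx
    rw [mem_closedBall] at hy ⊢
    linarith
  · refine (Continuous.integrableOn_Icc ?_).mono_set Set.Ioc_subset_Icc_self
    fun_prop
  · refine Eventually.of_forall fun θ x _ => ?_
    have h := (hf (x + circleMap 0 1 θ • u)).hasFDerivAt.comp x
      ((hasFDerivAt_id x).add_const (circleMap 0 1 θ • u))
    simpa using h.const_mul (K θ)

end

section

variable {m : ℕ} {f : (Fin m → ℂ) → ℂ}

lemma Differentiable.dirDeriv (hf : Differentiable ℂ f) (u : Fin m → ℂ) :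
    Differentiable ℂ (_root_.dirDeriv u f) :=
  hf.fderiv_apply_const u

lemma Differentiable.iterate_dirDeriv (hf : Differentiable ℂ f) (u : Fin m → ℂ) (k : ℕ) :
    Differentiable ℂ ((_root_.dirDeriv u)^[k] f) := by
  induction k with
  | zero => exact hf
  | succ k ih => rw [Function.iterate_succ_apply']; exact ih.dirDeriv u

lemma iteratedDeriv_comp_line (hf : Differentiable ℂ f) (u z : Fin m → ℂ) (k : ℕ) :
    iteratedDeriv k (fun t : ℂ => f (z + t • u)) = fun t => (dirDeriv u)^[k] f (z + t • u) := by
  induction k with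
  | zero => simp
  | succ k ih =>
    rw [iteratedDeriv_succ, ih, Function.iterate_succ_apply']
    funext t
    exact ((hf.iterate_dirDeriv u k).hasDerivAt_comp_line z u t).deriv

end

/-- A solution of `g = g⁽ᵏ⁾` is of exponential type, with a constant given by its initial data. -/
lemma norm_le_mul_exp_of_iteratedDeriv_eq_self {g : ℂ → ℂ} (hg : Differentiable ℂ g) {k : ℕ}
    (hk : 1 ≤ k) (h : iteratedDeriv k g = g) (c z : ℂ) :
    ‖g z‖ ≤ (∑ j ∈ Finset.range k, ‖iteratedDeriv j g c‖) * Real.exp ‖z - c‖ := by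
  set M := ∑ j ∈ Finset.range k, ‖iteratedDeriv j g c‖
  have hM : ∀ j, ‖iteratedDeriv j g c‖ ≤ M := by
    intro j
    induction j using Nat.strong_induction_on with
    | _ j ih =>
      rcases lt_or_ge j k with hj | hj
      · exact Finset.single_le_sum (f := fun j => ‖iteratedDeriv j g c‖)
          (fun _ _ => norm_nonneg _) (Finset.mem_range.2 hj)
      · obtain ⟨i, rfl⟩ := Nat.exists_eq_add_of_le' hj
        have : iteratedDeriv (i + k) g = iteratedDeriv i g := by
          rw [iteratedDeriv_eq_iterate] at h
          rw [iteratedDeriv_eq_iterate, Function.iterate_add_apply, h, iteratedDeriv_eq_iterate]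
        rw [this]
        exact ih i (by omega)
  have hexp : HasSum (fun j : ℕ => M * (‖z - c‖ ^ j / j.factorial)) (M * Real.exp ‖z - c‖) := by
    rw [Real.exp_eq_exp_ℝ]
    exact (NormedSpace.expSeries_div_hasSum_exp (𝔸 := ℝ) ‖z - c‖).mul_left M
  refine (Complex.hasSum_taylorSeries_of_entire hg c z).norm_le_of_bounded hexp fun j => ?_
  rw [smul_eq_mul, smul_eq_mul, norm_mul, norm_mul, norm_inv, norm_pow, Complex.norm_natCast]
  calc _ ≤ ((j.factorial : ℝ)⁻¹) * (‖z - c‖ ^ j * M) := by gcongr; exact hM j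
    _ = _ := by ring

lemma iteratedDeriv_two_zero_of_re_le {φ : ℂ → ℂ} (hφ : Differentiable ℂ φ) {A : ℝ}
    (h : ∀ z, (φ z).re ≤ A + ‖z‖) : iteratedDeriv 2 φ 0 = 0 := by
  have key : ∀ R : ℝ, 1 ≤ R → ‖iteratedDeriv 2 φ 0‖ ≤ 2 * (2 * (|A| + 2) + 3 * ‖φ 0‖) / R := by
    intro R hR
    have hR0 : 0 < R := by linarith
    have hb := Complex.norm_iteratedDeriv_le_of_forall_mem_sphere_norm_le (c := 0) (R := R)
      (C := (2 * (|A| + 2) + 3 * ‖φ 0‖) * R) 2 hR0 hφ.diffContOnCl fun z hz => ?_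
    · refine hb.trans_eq ?_
      simp only [Nat.factorial_two, Nat.cast_ofNat]
      field_simp
    · rw [mem_sphere_zero_iff_norm] at hz
      have hbc := Complex.borelCaratheodory (f := φ) (M := |A| + 2 * R) (R := 2 * R) (z := z)
        (by positivity) hφ.differentiableOn (fun w hw => by
          have := h w
          rw [mem_ball_zero_iff] at hw
          have := le_abs_self A
          simp only [Set.mem_ofPred_eq]
          linarith) (by positivity) (by rw [mem_ball_zero_iff]; linarith)
      rw [hz] at hbc
      refine hbc.trans ?_
      have e : 2 * (|A| + 2 * R) * R / (2 * R - R) + ‖φ 0‖ * (2 * R + R) / (2 * R - R)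
          = 2 * (|A| + 2 * R) + 3 * ‖φ 0‖ := by
        have : 2 * R - R = R := by ring
        rw [this]; field_simp; ring
      rw [e]
      nlinarith [mul_nonneg (abs_nonneg A) (sub_nonneg.2 hR),
        mul_nonneg (norm_nonneg (φ 0)) (sub_nonneg.2 hR)]
  have hlim : Tendsto (fun R : ℝ => 2 * (2 * (|A| + 2) + 3 * ‖φ 0‖) / R) atTop (𝓝 0) :=
    tendsto_const_nhds.div_atTop tendsto_id
  exact norm_le_zero_iff.1 (ge_of_tendsto hlim ((eventually_ge_atTop 1).mono key))

/-- An entire function whose real part grows at most linearly has constant derivative. -/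
lemma deriv_eq_deriv_zero_of_re_le {φ : ℂ → ℂ} (hφ : Differentiable ℂ φ) {A : ℝ}
    (h : ∀ z, (φ z).re ≤ A + ‖z‖) (z : ℂ) : deriv φ z = deriv φ 0 := by
  refine is_const_of_deriv_eq_zero (hφ.deriv) (fun c => ?_) z 0
  have := iteratedDeriv_two_zero_of_re_le (φ := fun w => φ (w + c)) (A := A + ‖c‖) (by fun_prop)
    fun w => (h (w + c)).trans (by linarith [norm_add_le w c])
  rw [iteratedDeriv_comp_add_const] at this
  simpa [iteratedDeriv_succ] using this

/-- A zero-free entire function of exponential type at most one satisfies `g' = b g`. -/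
lemma exists_deriv_eq_const_mul {g : ℂ → ℂ} (hg : Differentiable ℂ g) (h0 : ∀ z, g z ≠ 0) {M : ℝ}
    (hM : ∀ z, ‖g z‖ ≤ M * Real.exp ‖z‖) : ∃ b : ℂ, ∀ z, deriv g z = b * g z := by
  obtain ⟨φ, hφ0, hφ⟩ := ((hg.deriv.div hg h0).isExactOn_univ).with_val_at 0 (Complex.log (g 0))
  replace hφ : ∀ z, HasDerivAt φ (deriv g z / g z) z := fun z => hφ z trivial
  have hφd : Differentiable ℂ φ := fun z => (hφ z).differentiableAt
  have hexp : ∀ z, g z = Complex.exp (φ z) := by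
    have hd : ∀ z, HasDerivAt (fun w => g w * Complex.exp (-φ w)) 0 z := fun z => by
      refine ((hg z).hasDerivAt.mul (hφ z).neg.cexp).congr_deriv ?_
      field_simp [h0 z]
      ring
    intro z
    have := is_const_of_deriv_eq_zero (fun z => (hd z).differentiableAt) (fun z => (hd z).deriv) z 0
    simp only [hφ0, Complex.exp_neg, Complex.exp_log (h0 0), mul_inv_cancel₀ (h0 0)] at this
    exact (eq_of_mul_inv_eq_one this)
  have hMpos : 0 < M := by
    have := (norm_pos_iff.2 (h0 0)).trans_le (hM 0)
    simpa using this
  refine ⟨deriv φ 0, fun z => ?_⟩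
  rw [← deriv_eq_deriv_zero_of_re_le hφd (A := Real.log M) (fun w => ?_) z, (hφ z).deriv,
    div_mul_cancel₀ _ (h0 z)]
  have := hM w
  rw [hexp w, Complex.norm_exp, ← Real.exp_log hMpos, ← Real.exp_add, Real.exp_le_exp] at this
  simpa using this

lemma exists_iteratedDeriv_pow_eq {g : ℂ → ℂ} (hg : Differentiable ℂ g) (n j : ℕ) (hj : j ≤ n) :
    ∃ h : ℂ → ℂ, Differentiable ℂ h ∧
      iteratedDeriv j (fun t => g t ^ n) = fun t => g t ^ (n - j) * h t := by
  induction j with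
  | zero => exact ⟨fun _ => 1, by fun_prop, by simp⟩
  | succ j ih =>
    obtain ⟨h, hh, e⟩ := ih (by omega)
    refine ⟨fun t => (n - j : ℕ) * deriv g t * h t + g t * deriv h t, ?_, ?_⟩
    · have := hg.deriv
      have := hh.deriv
      fun_prop
    · obtain ⟨l, hl⟩ : ∃ l, n - j = l + 1 := ⟨n - j - 1, by omega⟩
      rw [iteratedDeriv_succ, e]
      funext t
      rw [(((hg t).hasDerivAt.fun_pow (n - j)).fun_mul (hh t).hasDerivAt).deriv,
        show n - (j + 1) = l by omega, hl]
      simp only [Nat.add_sub_cancel]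
      ring

lemma iteratedDeriv_eq_pow_mul {g : ℂ → ℂ} {b : ℂ} (hg : Differentiable ℂ g)
    (h : ∀ z, deriv g z = b * g z) (k : ℕ) : iteratedDeriv k g = fun z => b ^ k * g z := by
  induction k with
  | zero => simp
  | succ k ih =>
    rw [iteratedDeriv_succ, ih]
    funext z
    rw [deriv_const_mul _ (hg z), h z]
    ring

/-- In one variable, `gⁿ = (gⁿ)⁽ᵏ⁾` with `k < n` forces `(n g')ᵏ = gᵏ`. -/
lemma nat_mul_deriv_pow_eq {g : ℂ → ℂ} (hg : Differentiable ℂ g) {k n : ℕ} (hk : 1 ≤ k)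
    (hn : k + 1 ≤ n) (h : iteratedDeriv k (fun t => g t ^ n) = fun t => g t ^ n) (t : ℂ) :
    (n * deriv g t) ^ k = g t ^ k := by
  have hG : Differentiable ℂ fun t => g t ^ n := hg.pow n
  by_cases h0 : ∃ c, g c = 0
  · obtain ⟨c, hc⟩ := h0
    have hz : g = fun _ => 0 := by
      funext z
      have hb := norm_le_mul_exp_of_iteratedDeriv_eq_self hG hk h c z
      rw [Finset.sum_eq_zero, zero_mul, norm_le_zero_iff] at hb
      · exact eq_zero_of_pow_eq_zero hb
      · intro j hj
        rw [Finset.mem_range] at hj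
        obtain ⟨r, -, e⟩ := exists_iteratedDeriv_pow_eq hg n j (by omega)
        rw [e]
        simp [hc, show n - j ≠ 0 by omega]
    simp [hz]
  · push Not at h0
    obtain ⟨b, hb⟩ := exists_deriv_eq_const_mul hG (fun z => pow_ne_zero n (h0 z)) fun z => by
      simpa using norm_le_mul_exp_of_iteratedDeriv_eq_self hG hk h 0 z
    have hbk : b ^ k = 1 := by
      have := congrFun ((iteratedDeriv_eq_pow_mul hG hb k).symm.trans h) t
      exact (mul_eq_right₀ (pow_ne_zero n (h0 t))).1 this
    have hd : (n : ℂ) * deriv g t = b * g t := by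
      have := hb t
      rw [((hg t).hasDerivAt.fun_pow n).deriv] at this
      refine mul_right_cancel₀ (pow_ne_zero (n - 1) (h0 t)) ?_
      rw [mul_assoc b, ← pow_succ', Nat.sub_add_cancel (by omega), ← this]
      ring
    rw [hd, mul_pow, hbk, one_mul]

lemma finite_setOf_pow_eq_one {k : ℕ} (hk : 1 ≤ k) : {x : ℂ | x ^ k = 1}.Finite := by
  refine (Polynomial.nthRootsFinset k (1 : ℂ)).finite_toSet.subset fun x hx => ?_
  simpa [Polynomial.mem_nthRootsFinset hk] using hx

/-- Entire functions with equal `k`-th powers differ by a constant factor. -/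
lemma eq_div_mul_of_pow_eq_pow {φ ψ : ℂ → ℂ} (hφ : Differentiable ℂ φ) (hψ : Differentiable ℂ ψ)
    {k : ℕ} (hk : 1 ≤ k) (h : ∀ t, ψ t ^ k = φ t ^ k) {c : ℂ} (hc : φ c ≠ 0) (t : ℂ) :
    ψ t = ψ c / φ c * φ t := by
  have hcont : ContinuousAt (fun t => ψ t / φ t) c :=
    hψ.continuous.continuousAt.div hφ.continuous.continuousAt hc
  have hopen : ({x : ℂ | x ^ k = 1} \ {ψ c / φ c})ᶜ ∈ 𝓝 (ψ c / φ c) :=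
    ((finite_setOf_pow_eq_one hk).subset Set.sdiff_subset).isClosed.isOpen_compl.mem_nhds (by simp)
  have hev : ψ =ᶠ[𝓝 c] fun t => ψ c / φ c * φ t := by
    filter_upwards [hcont hopen, hφ.continuous.continuousAt.eventually_ne hc] with s hs hs0
    have h1 : (ψ s / φ s) ^ k = 1 := by rw [div_pow, h s, div_self (pow_ne_zero k hs0)]
    have h2 : ψ s / φ s = ψ c / φ c := by
      by_contra hne
      exact hs ⟨h1, hne⟩
    rw [← h2, div_mul_cancel₀ _ hs0]
  have hψa : AnalyticOnNhd ℂ ψ Set.univ := fun z _ => hψ.analyticAt z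
  have hφa : AnalyticOnNhd ℂ (fun t => ψ c / φ c * φ t) Set.univ :=
    fun z _ => (hφ.const_mul _).analyticAt z
  exact congrFun (hψa.eq_of_eventuallyEq hφa hev) t

/-- Case 2 of the proof of the paper's Theorem 2.1: if `f^n ≡ ∂_u^k (f^n)`, then
`f ≡ c ∂_u f` for some nonzero `c` with `(c/n)^k = 1`. -/
theorem power_eq_directional_derivative
    (m : ℕ) (hm : 1 ≤ m) (f : (Fin m → ℂ) → ℂ)
    (hf : Differentiable ℂ f) (hnc : ¬∃ c : ℂ, ∀ z, f z = c)
    (u : Fin m → ℂ) (hu : ∑ j, Complex.normSq (u j) = 1)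
    (k n : ℕ) (hk : 1 ≤ k) (hn : k + 1 ≤ n)
    (hne : ¬∀ z, (dirDeriv u)^[k] (fun w => f w ^ n) z = 0)
    (heq : ∀ z, f z ^ n = (dirDeriv u)^[k] (fun w => f w ^ n) z) :
    ∃ c : ℂ, c ≠ 0 ∧ (c / (n : ℂ)) ^ k = 1 ∧ ∀ z, f z = c * dirDeriv u f z := by
  have hpow : ∀ z, (n * dirDeriv u f z) ^ k = f z ^ k := by
    intro z
    have h := nat_mul_deriv_pow_eq (hf.comp_line z u) hk hn (by
      rw [iteratedDeriv_comp_line (f := fun w => f w ^ n) (hf.pow n) u z k]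
      exact funext fun t => (heq _).symm) 0
    rw [(hf.hasDerivAt_comp_line z u 0).deriv] at h
    simpa [dirDeriv] using h
  obtain ⟨a, ha⟩ : ∃ a, f a ≠ 0 := by
    by_contra! h
    exact hnc ⟨0, h⟩
  have hn0 : (n : ℂ) ≠ 0 := Nat.cast_ne_zero.2 (by omega)
  set b := n * dirDeriv u f a / f a with hb
  have hbk : b ^ k = 1 := by rw [hb, div_pow, hpow a, div_self (pow_ne_zero k ha)]
  have hb0 : b ≠ 0 := by
    rintro h
    rw [h, zero_pow (by omega)] at hbk
    exact zero_ne_one hbk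
  have hfb : ∀ z, n * dirDeriv u f z = b * f z := fun z => by
    have h := eq_div_mul_of_pow_eq_pow (hf.comp_line a (z - a))
      (((hf.dirDeriv u).comp_line a (z - a)).const_mul (n : ℂ)) hk (fun t => hpow _) (c := 0)
      (by simpa using ha) 1
    simpa [hb] using h
  refine ⟨n / b, div_ne_zero hn0 hb0, ?_, fun z => ?_⟩
  · rw [div_div_cancel_left' hn0, inv_pow, hbk, inv_one]
  · rw [div_mul_eq_mul_div, hfb z, mul_div_cancel_left₀ _ hb0]
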